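/- arXiv:cs/0408062 — 5 statements merged into one kernel-verified Lean document; each statement's English description precedes it below -/
import Mathlib

section
/- Let F be a finite field and let n ≤ |F| and k ≤ n. There exist an encoder f, mapping each pair (x, S) — where x : Fin n → F is a source sequence and S ⊆ Fin n is a subset of size k — to a tuple in F^k, and a decoder g : F^k → (Fin n → F) (which does not see S), such that for every source x and every size-k subset S, the reconstruction g(f(x, S)) agrees with x at every coordinate i ∈ S. -/
/-- **Reed–Solomon / MDS erasure-coding example (Section 2.1).**
For a finite field `F` with `n ≤ |F|` and `k ≤ n`, there is an encoder `f`
(seeing the source `x : Fin n → F` and the side information `S`, a size-`k`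
subset of relevant coordinates) producing only `k` field symbols, and a
decoder `g` (not seeing `S`), such that the reconstruction `g (f x S)`
agrees with `x` on every relevant coordinate `i ∈ S`. -/
theorem lossless_encoding_of_relevant_samples
    (F : Type*) [Field F] [Fintype F] (n k : ℕ)
    (hn : n ≤ Fintype.card F) (hk : k ≤ n) :
    ∃ (f : (Fin n → F) → Finset (Fin n) → (Fin k → F))
      (g : (Fin k → F) → (Fin n → F)),
      ∀ (x : Fin n → F) (S : Finset (Fin n)), S.card = k →
        ∀ i ∈ S, g (f x S) i = x i := by
  classical
  obtain ⟨v⟩ : Nonempty (Fin n ↪ F) :=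
    Function.Embedding.nonempty_of_card_le (by simpa using hn)
  refine ⟨fun x S j => (Lagrange.interpolate S v x).coeff j,
    fun c i => ∑ j, c j * v i ^ (j : ℕ), fun x S hS i hi => ?_⟩
  have hdeg : Lagrange.interpolate S v x ∈ Polynomial.degreeLT F k := by
    rw [Polynomial.mem_degreeLT, ← hS]
    exact Lagrange.degree_interpolate_lt x v.injective.injOn
  rw [← Lagrange.eval_interpolate_at_node x v.injective.injOn hi]
  exact (Polynomial.eval_eq_sum_degreeLTEquiv hdeg (v i)).symm
end

section
/- Let Ω be a probability space, G a nontrivial finite group with the discrete measurable structure, and Q a finite measurable space. Let X : Ω → G be uniformly distributed on G, let S : Ω → Q be independent of X, and let X̂ : Ω → G be any random variable (measurable, jointly defined with X and S). Then, with entropies in nats, I[X̂ : (X, S)] ≥ log|G| − H[X̂ * X⁻¹ | S]. -/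
open MeasureTheory ProbabilityTheory
open scoped ENNReal

/-- Shannon entropy (in nats) of a random variable with values in a finite set. -/
noncomputable def shannonEntropy {Ω α : Type*} [MeasurableSpace Ω] [Fintype α]
    (μ : Measure Ω) (X : Ω → α) : ℝ :=
  ∑ a : α, Real.negMulLog (μ (X ⁻¹' {a})).toReal

/-- Conditional Shannon entropy `H[X | Y] = H[(X, Y)] - H[Y]` (in nats). -/
noncomputable def condShannonEntropy {Ω α β : Type*} [MeasurableSpace Ω] [Fintype α] [Fintype β]
    (μ : Measure Ω) (X : Ω → α) (Y : Ω → β) : ℝ :=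
  shannonEntropy μ (fun ω => (X ω, Y ω)) - shannonEntropy μ Y

/-- Mutual information `I[X : Y] = H[X] + H[Y] - H[(X, Y)]` (in nats). -/
noncomputable def mutualInfoRV {Ω α β : Type*} [MeasurableSpace Ω] [Fintype α] [Fintype β]
    (μ : Measure Ω) (X : Ω → α) (Y : Ω → β) : ℝ :=
  shannonEntropy μ X + shannonEntropy μ Y - shannonEntropy μ (fun ω => (X ω, Y ω))

section Entropy

variable {Ω α β : Type*} [MeasurableSpace Ω] [Fintype α] [Fintype β]

/-- Shannon entropy is invariant under relabelling the values. -/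
theorem shannonEntropy_equiv_comp (μ : Measure Ω) (e : α ≃ β) (X : Ω → α) :
    shannonEntropy μ (fun ω => e (X ω)) = shannonEntropy μ X := by
  refine (Fintype.sum_equiv e _ _ fun a => ?_).symm
  congr 3
  ext ω
  simp

/-- A uniformly distributed random variable on `α` has entropy `log |α|`. -/
theorem shannonEntropy_of_uniform [Nonempty α] (μ : Measure Ω) (X : Ω → α)
    (hunif : ∀ a, μ (X ⁻¹' {a}) = ((Fintype.card α : ℝ≥0∞))⁻¹) :
    shannonEntropy μ X = Real.log (Fintype.card α) := by
  simp [shannonEntropy, hunif, Real.negMulLog]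

theorem shannonEntropy_prodMk (μ : Measure Ω) (X : Ω → α) (Y : Ω → β) :
    shannonEntropy μ (fun ω => (X ω, Y ω)) =
      ∑ a, ∑ b, Real.negMulLog (μ.real (X ⁻¹' {a} ∩ Y ⁻¹' {b})) := by
  rw [shannonEntropy, Fintype.sum_prod_type]
  simp only [← Set.singleton_prod_singleton, Set.mk_preimage_prod, measureReal_def]

variable [MeasurableSpace α] [MeasurableSingletonClass α]
  [MeasurableSpace β] [MeasurableSingletonClass β]

theorem sum_measureReal_preimage_singleton_inter (μ : Measure Ω) [IsFiniteMeasure μ]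
    {X : Ω → α} (hX : Measurable X) (s : Set Ω) :
    ∑ a, μ.real (X ⁻¹' {a} ∩ s) = μ.real s := by
  have h := sum_measureReal_preimage_singleton (μ := μ.restrict s) (Finset.univ : Finset α)
    (f := X) fun a _ => hX (measurableSet_singleton a)
  simpa [measureReal_restrict_apply (hX (measurableSet_singleton _))] using h

theorem sum_measureReal_preimage_singleton_eq_one (μ : Measure Ω) [IsProbabilityMeasure μ]
    {X : Ω → α} (hX : Measurable X) : ∑ a, μ.real (X ⁻¹' {a}) = 1 := by
  simpa using sum_measureReal_preimage_singleton_inter μ hX Set.univ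

/-- The entropy of a pair of independent random variables is the sum of their entropies. -/
theorem shannonEntropy_prodMk_of_indepFun (μ : Measure Ω) [IsProbabilityMeasure μ]
    {X : Ω → α} {Y : Ω → β} (hX : Measurable X) (hY : Measurable Y) (h : IndepFun X Y μ) :
    shannonEntropy μ (fun ω => (X ω, Y ω)) = shannonEntropy μ X + shannonEntropy μ Y := by
  have hmul (a : α) (b : β) :
      μ.real (X ⁻¹' {a} ∩ Y ⁻¹' {b}) = μ.real (X ⁻¹' {a}) * μ.real (Y ⁻¹' {b}) := by
    simp [measureReal_def, h.measure_inter_preimage_eq_mul _ _ (measurableSet_singleton a)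
      (measurableSet_singleton b)]
  simp_rw [shannonEntropy_prodMk, hmul, Real.negMulLog_mul, Finset.sum_add_distrib,
    ← Finset.sum_mul, ← Finset.mul_sum, ← Finset.sum_mul,
    sum_measureReal_preimage_singleton_eq_one μ hX, sum_measureReal_preimage_singleton_eq_one μ hY,
    one_mul, shannonEntropy, measureReal_def]

/-- Gibbs' inequality, pointwise. -/
theorem Real.negMulLog_le_of_le_of_le {p x y : ℝ} (hp : 0 ≤ p) (hx : p ≤ x) (hy : p ≤ y) :
    Real.negMulLog p ≤ -(p * Real.log x) - p * Real.log y + (x * y - p) := by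
  rcases hp.eq_or_lt with rfl | hp
  · simpa using mul_nonneg hx hy
  have hx0 := hp.trans_le hx
  have hy0 := hp.trans_le hy
  have h := mul_le_mul_of_nonneg_left
    (Real.log_le_sub_one_of_pos (div_pos (mul_pos hx0 hy0) hp)) hp.le
  rw [Real.log_div (mul_pos hx0 hy0).ne' hp.ne', Real.log_mul hx0.ne' hy0.ne', mul_sub,
    mul_sub, mul_div_cancel₀ _ hp.ne'] at h
  rw [Real.negMulLog]
  linarith

/-- Subadditivity of Shannon entropy. -/
theorem shannonEntropy_prodMk_le (μ : Measure Ω) [IsProbabilityMeasure μ]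
    {X : Ω → α} {Y : Ω → β} (hX : Measurable X) (hY : Measurable Y) :
    shannonEntropy μ (fun ω => (X ω, Y ω)) ≤ shannonEntropy μ X + shannonEntropy μ Y := by
  have hfst (a : α) : ∑ b, μ.real (X ⁻¹' {a} ∩ Y ⁻¹' {b}) = μ.real (X ⁻¹' {a}) := by
    simp_rw [Set.inter_comm (X ⁻¹' {a})]
    exact sum_measureReal_preimage_singleton_inter μ hY _
  have hsnd (b : β) : ∑ a, μ.real (X ⁻¹' {a} ∩ Y ⁻¹' {b}) = μ.real (Y ⁻¹' {b}) :=
    sum_measureReal_preimage_singleton_inter μ hX _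
  rw [shannonEntropy_prodMk]
  calc
    _ ≤ ∑ a, ∑ b, (-(μ.real (X ⁻¹' {a} ∩ Y ⁻¹' {b}) * Real.log (μ.real (X ⁻¹' {a})))
          - μ.real (X ⁻¹' {a} ∩ Y ⁻¹' {b}) * Real.log (μ.real (Y ⁻¹' {b}))
          + (μ.real (X ⁻¹' {a}) * μ.real (Y ⁻¹' {b}) - μ.real (X ⁻¹' {a} ∩ Y ⁻¹' {b}))) := by
      gcongr with a _ b _
      exact Real.negMulLog_le_of_le_of_le measureReal_nonneg
        (measureReal_mono Set.inter_subset_left) (measureReal_mono Set.inter_subset_right)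
    _ = shannonEntropy μ X + shannonEntropy μ Y := by
      simp_rw [Finset.sum_add_distrib, Finset.sum_sub_distrib, Finset.sum_neg_distrib,
        ← Finset.mul_sum, ← Finset.sum_mul, hfst]
      rw [Finset.sum_comm (f := fun a b =>
        μ.real (X ⁻¹' {a} ∩ Y ⁻¹' {b}) * Real.log (μ.real (Y ⁻¹' {b})))]
      simp_rw [← Finset.sum_mul, hsnd, sum_measureReal_preimage_singleton_eq_one μ hX,
        sum_measureReal_preimage_singleton_eq_one μ hY, shannonEntropy, Real.negMulLog,
        measureReal_def, neg_mul, Finset.sum_neg_distrib]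
      ring

end Entropy

/-- **Lower-bound chain in the proof of Theorem 1 (eqs. (10)–(13)).**
For `X` uniform on a nontrivial finite group `G`, side information `S`
independent of `X`, and any reconstruction `X̂`,
`I[X̂ : (X, S)] ≥ log |G| - H[X̂ * X⁻¹ | S]` (entropies in nats). -/
theorem mutualInfo_ge_log_card_sub_condEntropy
    {Ω G Q : Type*} [MeasurableSpace Ω]
    [Group G] [Fintype G] [Nontrivial G] [MeasurableSpace G] [DiscreteMeasurableSpace G]
    [Fintype Q] [MeasurableSpace Q] [DiscreteMeasurableSpace Q]
    (μ : Measure Ω) [IsProbabilityMeasure μ]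
    (X : Ω → G) (S : Ω → Q) (Xhat : Ω → G)
    (hX : Measurable X) (hS : Measurable S) (hXhat : Measurable Xhat)
    (hunif : ∀ g : G, μ (X ⁻¹' {g}) = ((Fintype.card G : ℝ≥0∞))⁻¹)
    (hindep : IndepFun X S μ) :
    mutualInfoRV μ Xhat (fun ω => (X ω, S ω)) ≥
      Real.log (Fintype.card G) - condShannonEntropy μ (fun ω => Xhat ω * (X ω)⁻¹) S := by
  let e : G × G × Q ≃ G × G × Q :=
    { toFun := fun p => (p.1, p.1 * p.2.1⁻¹, p.2.2)
      invFun := fun p => (p.1, p.2.1⁻¹ * p.1, p.2.2)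
      left_inv := fun p => by simp
      right_inv := fun p => by simp }
  have hdiff : Measurable fun ω => Xhat ω * (X ω)⁻¹ := hXhat.mul hX.inv
  have hjoint := shannonEntropy_equiv_comp μ e fun ω => (Xhat ω, X ω, S ω)
  have hsub := shannonEntropy_prodMk_le μ hXhat (hdiff.prodMk hS)
  have hXS := shannonEntropy_prodMk_of_indepFun μ hX hS hindep
  rw [shannonEntropy_of_uniform μ X hunif] at hXS
  simp only [e, Equiv.coe_fn_mk] at hjoint
  rw [mutualInfoRV, condShannonEntropy]
  linarith
end

section
/- Let (Ω, μ) be a probability space and let X, U, S be random variables taking values in finite sets 𝒳, 𝒰, 𝒬 respectively, such that S is independent of (X, U). Let d₀ : 𝒬 → ℝ with d₀(q) > 0 for all q, let 𝒳̂ be a finite set, and let d₁ : 𝒳̂ × 𝒳 → ℝ. Then for every q ∈ 𝒬 and u ∈ 𝒰 with μ(S = q, U = u) > 0, the set of minimizers over x̂ ∈ 𝒳̂ of E[ d₀(S)·d₁(x̂, X) | S = q, U = u ] equals the set of minimizers over x̂ of E[ d₁(x̂, X) | U = u ]; in particular, an optimal reconstruction function v(u, q) can be chosen to not depend on q. -/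
open MeasureTheory ProbabilityTheory

/-- If `S` is independent of `(X, U)`, then conditioning on an event of `S` of positive probability
in addition to an event of `U` does not change the law of `X`. -/
theorem map_cond_preimage_inter_of_indepFun {Ω α β γ : Type*} [MeasurableSpace Ω]
    [MeasurableSpace α] [MeasurableSpace β] [MeasurableSpace γ]
    {μ : Measure Ω} [IsFiniteMeasure μ] {X : Ω → α} {U : Ω → β} {S : Ω → γ}
    (hX : Measurable X) (hU : Measurable U) (hS : Measurable S)
    (hindep : IndepFun (fun ω => (X ω, U ω)) S μ)
    {s : Set γ} {t : Set β} (hs : MeasurableSet s) (ht : MeasurableSet t)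
    (hpos : μ (S ⁻¹' s) ≠ 0) :
    (μ[|S ⁻¹' s ∩ U ⁻¹' t]).map X = (μ[|U ⁻¹' t]).map X := by
  have key : ∀ b : Set α, MeasurableSet b →
      μ (S ⁻¹' s ∩ U ⁻¹' t ∩ X ⁻¹' b) = μ (S ⁻¹' s) * μ (U ⁻¹' t ∩ X ⁻¹' b) := by
    intro b hb
    have h := hindep.measure_inter_preimage_eq_mul (b ×ˢ t) s (hb.prod ht) hs
    have hpre : (fun ω => (X ω, U ω)) ⁻¹' (b ×ˢ t) = U ⁻¹' t ∩ X ⁻¹' b := by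
      ext ω
      simp [and_comm]
    rw [hpre] at h
    rw [Set.inter_assoc, Set.inter_comm, h, mul_comm]
  have huniv : μ (S ⁻¹' s ∩ U ⁻¹' t) = μ (S ⁻¹' s) * μ (U ⁻¹' t) := by
    simpa using key Set.univ MeasurableSet.univ
  ext b hb
  rw [Measure.map_apply hX hb, Measure.map_apply hX hb,
    cond_apply ((hS hs).inter (hU ht)), cond_apply (hU ht), key b hb, huniv,
    ENNReal.mul_inv (Or.inl hpos) (Or.inl (measure_ne_top _ _)), mul_mul_mul_comm,
    ENNReal.inv_mul_cancel hpos (measure_ne_top _ _), one_mul]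

/-- **Conclusion of the proof of Theorem 3.**
For scaled distortion measures `d₀(q)·d₁(x̂, x)` with `d₀ > 0` and side
information `S` independent of `(X, U)`, the minimizers over `x̂` of the
conditional expected distortion given `{S = q, U = u}` coincide with the
minimizers of `E[d₁(x̂, X) | U = u]`; hence an optimal reconstruction
function `v(u, q)` can be chosen not to depend on `q`. -/
theorem argmin_scaled_distortion_independent_of_sideInfo
    {Ω 𝒳 𝒰 𝒬 𝒳hat : Type*} [MeasurableSpace Ω]
    [Fintype 𝒳] [MeasurableSpace 𝒳] [DiscreteMeasurableSpace 𝒳]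
    [Fintype 𝒰] [MeasurableSpace 𝒰] [DiscreteMeasurableSpace 𝒰]
    [Fintype 𝒬] [MeasurableSpace 𝒬] [DiscreteMeasurableSpace 𝒬]
    [Fintype 𝒳hat]
    (μ : Measure Ω) [IsProbabilityMeasure μ]
    (X : Ω → 𝒳) (U : Ω → 𝒰) (S : Ω → 𝒬)
    (hX : Measurable X) (hU : Measurable U) (hS : Measurable S)
    (hindep : IndepFun (fun ω => (X ω, U ω)) S μ)
    (d₀ : 𝒬 → ℝ) (hd₀ : ∀ q, 0 < d₀ q) (d₁ : 𝒳hat × 𝒳 → ℝ)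
    (q : 𝒬) (u : 𝒰)
    (hpos : 0 < μ {ω | S ω = q ∧ U ω = u}) :
    {xhat : 𝒳hat | ∀ y : 𝒳hat,
        ∫ ω, d₀ (S ω) * d₁ (xhat, X ω) ∂(μ[|{ω | S ω = q ∧ U ω = u}]) ≤
        ∫ ω, d₀ (S ω) * d₁ (y, X ω) ∂(μ[|{ω | S ω = q ∧ U ω = u}])} =
    {xhat : 𝒳hat | ∀ y : 𝒳hat,
        ∫ ω, d₁ (xhat, X ω) ∂(μ[|{ω | U ω = u}]) ≤
        ∫ ω, d₁ (y, X ω) ∂(μ[|{ω | U ω = u}])} := by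
  have hset : {ω | S ω = q ∧ U ω = u} = S ⁻¹' {q} ∩ U ⁻¹' {u} := rfl
  have hsetU : {ω | U ω = u} = U ⁻¹' {u} := rfl
  have hq : MeasurableSet ({q} : Set 𝒬) := .of_discrete
  have hu : MeasurableSet ({u} : Set 𝒰) := .of_discrete
  have hSq : μ (S ⁻¹' {q}) ≠ 0 := fun h =>
    hpos.ne' (measure_mono_null (fun _ hω => hω.1) h)
  have hmap := map_cond_preimage_inter_of_indepFun hX hU hS hindep hq hu hSq
  have hint : ∀ y : 𝒳hat,
      ∫ ω, d₀ (S ω) * d₁ (y, X ω) ∂(μ[|{ω | S ω = q ∧ U ω = u}]) =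
        d₀ q * ∫ ω, d₁ (y, X ω) ∂(μ[|{ω | U ω = u}]) := by
    intro y
    have hd : Measurable fun x => d₁ (y, x) := .of_discrete
    rw [hset, hsetU, ← integral_map hX.aemeasurable hd.aestronglyMeasurable, ← hmap,
      integral_map hX.aemeasurable hd.aestronglyMeasurable, ← integral_const_mul]
    refine integral_congr_ae ?_
    filter_upwards [ae_cond_mem ((hS hq).inter (hU hu))] with ω hω
    rw [show S ω = q from hω.1]
  ext xhat
  simp only [Set.mem_ofPred_eq, hint, mul_le_mul_iff_right₀ (hd₀ q)]
end

section
/- Let (Ω, μ) be a probability space, X and U random variables on Ω with values in finite sets 𝒳 and 𝒰, S a random variable with values in a finite set 𝒬 that is independent of (X, U), d₀ : 𝒬 → ℝ nonnegative, 𝒳̂ a finite set, and d₁ : 𝒳 × 𝒳̂ → ℝ. Then for every reconstruction function v : 𝒰 × 𝒬 → 𝒳̂ there exists a reconstruction function v' : 𝒰 → 𝒳̂ (not depending on the side information) such that E[ d₀(S)·d₁(X, v'(U)) ] ≤ E[ d₀(S)·d₁(X, v(U, S)) ]. -/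
open MeasureTheory ProbabilityTheory

/-- The expected scaled distortion of a decoder observing `(U, S)`, written as a finite sum. -/
theorem integral_scaled_distortion_eq_sum
    {Ω 𝒳 𝒰 𝒬 𝒳hat : Type*} [MeasurableSpace Ω]
    [Fintype 𝒳] [MeasurableSpace 𝒳] [DiscreteMeasurableSpace 𝒳]
    [Fintype 𝒰] [MeasurableSpace 𝒰] [DiscreteMeasurableSpace 𝒰]
    [Fintype 𝒬] [MeasurableSpace 𝒬] [DiscreteMeasurableSpace 𝒬]
    {μ : Measure Ω} [IsProbabilityMeasure μ]
    {X : Ω → 𝒳} {U : Ω → 𝒰} {S : Ω → 𝒬}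
    (hX : Measurable X) (hU : Measurable U) (hS : Measurable S)
    (hindep : IndepFun (fun ω => (X ω, U ω)) S μ)
    (d₀ : 𝒬 → ℝ) (d₁ : 𝒳 × 𝒳hat → ℝ) (w : 𝒰 × 𝒬 → 𝒳hat) :
    ∫ ω, d₀ (S ω) * d₁ (X ω, w (U ω, S ω)) ∂μ =
      ∑ q, (μ.map S).real {q} * d₀ q *
        ∑ u, ∑ x, (μ.map fun ω => (X ω, U ω)).real {(x, u)} * d₁ (x, w (u, q)) := by
  have hXU : Measurable fun ω => (X ω, U ω) := hX.prodMk hU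
  have : IsProbabilityMeasure (μ.map fun ω => (X ω, U ω)) :=
    Measure.isProbabilityMeasure_map hXU.aemeasurable
  have : IsProbabilityMeasure (μ.map S) := Measure.isProbabilityMeasure_map hS.aemeasurable
  have hlaw := (indepFun_iff_map_prod_eq_prod_map_map hXU.aemeasurable hS.aemeasurable).1 hindep
  let f : (𝒳 × 𝒰) × 𝒬 → ℝ := fun p => d₀ p.2 * d₁ (p.1.1, w (p.1.2, p.2))
  have hmap : ∫ p, f p ∂(μ.map fun ω => ((X ω, U ω), S ω)) = ∫ ω, f ((X ω, U ω), S ω) ∂μ :=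
    integral_map (hXU.prodMk hS).aemeasurable
      (Measurable.of_discrete (f := f)).aestronglyMeasurable
  change ∫ ω, f ((X ω, U ω), S ω) ∂μ = _
  rw [← hmap, hlaw, integral_fintype .of_finite, Fintype.sum_prod_type_right]
  refine Finset.sum_congr rfl fun q _ => ?_
  rw [Fintype.sum_prod_type_right, Finset.mul_sum]
  refine Finset.sum_congr rfl fun u _ => ?_
  rw [Finset.mul_sum]
  refine Finset.sum_congr rfl fun x _ => ?_
  rw [← Set.singleton_prod_singleton, measureReal_prod_prod, smul_eq_mul]
  ring

/-- **Operational content of Theorem 3.**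
For scaled distortion measures `d₀(q)·d₁(x, x̂)` with nonnegative `d₀` and
side information `S` independent of `(X, U)`, any reconstruction function
`v : 𝒰 × 𝒬 → 𝒳̂` that uses the side information can be replaced by one
`v' : 𝒰 → 𝒳̂` ignoring it, without increasing the expected distortion. -/
theorem decoder_sideInfo_useless_for_scaled_distortion
    {Ω 𝒳 𝒰 𝒬 𝒳hat : Type*} [MeasurableSpace Ω]
    [Fintype 𝒳] [MeasurableSpace 𝒳] [DiscreteMeasurableSpace 𝒳]
    [Fintype 𝒰] [MeasurableSpace 𝒰] [DiscreteMeasurableSpace 𝒰]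
    [Fintype 𝒬] [MeasurableSpace 𝒬] [DiscreteMeasurableSpace 𝒬]
    [Fintype 𝒳hat]
    (μ : Measure Ω) [IsProbabilityMeasure μ]
    (X : Ω → 𝒳) (U : Ω → 𝒰) (S : Ω → 𝒬)
    (hX : Measurable X) (hU : Measurable U) (hS : Measurable S)
    (hindep : IndepFun (fun ω => (X ω, U ω)) S μ)
    (d₀ : 𝒬 → ℝ) (hd₀ : ∀ q, 0 ≤ d₀ q) (d₁ : 𝒳 × 𝒳hat → ℝ)
    (v : 𝒰 × 𝒬 → 𝒳hat) :
    ∃ v' : 𝒰 → 𝒳hat,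
      ∫ ω, d₀ (S ω) * d₁ (X ω, v' (U ω)) ∂μ ≤
      ∫ ω, d₀ (S ω) * d₁ (X ω, v (U ω, S ω)) ∂μ := by
  obtain ⟨ω₀⟩ := μ.nonempty_of_neZero
  have : Nonempty 𝒳hat := ⟨v (U ω₀, S ω₀)⟩
  choose v' hv' using fun u => Finite.exists_min fun y : 𝒳hat =>
    ∑ x, (μ.map fun ω => (X ω, U ω)).real {(x, u)} * d₁ (x, y)
  refine ⟨v', ?_⟩
  rw [integral_scaled_distortion_eq_sum hX hU hS hindep d₀ d₁ v,
    integral_scaled_distortion_eq_sum hX hU hS hindep d₀ d₁ fun p => v' p.1]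
  exact Finset.sum_le_sum fun q _ => mul_le_mul_of_nonneg_left
    (Finset.sum_le_sum fun u _ => hv' u (v (u, q))) (mul_nonneg measureReal_nonneg (hd₀ q))
end

section
/- Let G be a finite group, 𝒬 a finite set, p : 𝒬 → ℝ≥0 a probability mass function, d : G × 𝒬 → ℝ, and D a real number. For a channel W assigning to each (x, q) ∈ G × 𝒬 a probability mass function W(x,q) on G, define the joint distribution P(x, q, x̂) = |G|⁻¹ · p(q) · W(x,q)(x̂), the average distortion Δ(W) = Σ_{x,q,x̂} P(x,q,x̂) · d(x̂ * x⁻¹, q), the mutual information I_enc(W) = I((X,S); X̂) and the conditional mutual information I_both(W) = I(X; X̂ | S), both computed from P by the standard finite-alphabet formulas. If the constraint set {W : Δ(W) ≤ D} is nonempty, then inf{ I_enc(W) : Δ(W) ≤ D } = inf{ I_both(W) : Δ(W) ≤ D }. -/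
open Finset

namespace SourceCodingDSI

variable {G Q : Type*} [Fintype G] [Group G] [Fintype Q]

/-- A test channel: for every `(x, q)` a probability mass function on `G`. -/
def IsChannel (W : G × Q → G → ℝ) : Prop :=
  (∀ xq y, 0 ≤ W xq y) ∧ ∀ xq, ∑ y : G, W xq y = 1

/-- Joint distribution `P(x, q, x̂) = |G|⁻¹ · p(q) · W(x, q)(x̂)` of the
uniform source `X`, the independent side information `S ~ p`, and the
test-channel output `X̂`. -/
noncomputable def jointP (p : Q → ℝ) (W : G × Q → G → ℝ) (x : G) (q : Q) (y : G) : ℝ :=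
  (Fintype.card G : ℝ)⁻¹ * p q * W (x, q) y

/-- Marginal of `(X, S)`. -/
noncomputable def margXS (p : Q → ℝ) (W : G × Q → G → ℝ) (x : G) (q : Q) : ℝ :=
  ∑ y : G, jointP p W x q y

/-- Marginal of `X̂`. -/
noncomputable def margXhat (p : Q → ℝ) (W : G × Q → G → ℝ) (y : G) : ℝ :=
  ∑ x : G, ∑ q : Q, jointP p W x q y

/-- Marginal of `S`. -/
noncomputable def margS (p : Q → ℝ) (W : G × Q → G → ℝ) (q : Q) : ℝ :=
  ∑ x : G, ∑ y : G, jointP p W x q y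

/-- Marginal of `(S, X̂)`. -/
noncomputable def margSXhat (p : Q → ℝ) (W : G × Q → G → ℝ) (q : Q) (y : G) : ℝ :=
  ∑ x : G, jointP p W x q y

/-- Average distortion `Δ(W) = Σ P(x,q,x̂) · d(x̂ * x⁻¹, q)` for a
group-difference distortion measure. -/
noncomputable def avgDistortion (d : G → Q → ℝ) (p : Q → ℝ) (W : G × Q → G → ℝ) : ℝ :=
  ∑ x : G, ∑ q : Q, ∑ y : G, jointP p W x q y * d (y * x⁻¹) q

/-- Mutual information `I((X, S); X̂)` computed from `P` by the standard
finite-alphabet formula (in nats). -/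
noncomputable def Ienc (p : Q → ℝ) (W : G × Q → G → ℝ) : ℝ :=
  ∑ x : G, ∑ q : Q, ∑ y : G, jointP p W x q y *
    Real.log (jointP p W x q y / (margXS p W x q * margXhat p W y))

/-- Conditional mutual information `I(X; X̂ | S)` computed from `P` by the
standard finite-alphabet formula (in nats). -/
noncomputable def Iboth (p : Q → ℝ) (W : G × Q → G → ℝ) : ℝ :=
  ∑ x : G, ∑ q : Q, ∑ y : G, jointP p W x q y *
    Real.log ((jointP p W x q y * margS p W q) / (margXS p W x q * margSXhat p W q y))

set_option linter.unusedSectionVars false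

/-- The conditional law of `X̂ * X⁻¹` given `S = q` under the channel `W`. -/
noncomputable def diffLaw (W : G × Q → G → ℝ) (q : Q) (z : G) : ℝ :=
  (Fintype.card G : ℝ)⁻¹ * ∑ x : G, W (x, q) (z * x)

/-- The channel adding to `x` an independent noise with law `diffLaw W q`. -/
noncomputable def noiseChannel (W : G × Q → G → ℝ) (xq : G × Q) (y : G) : ℝ :=
  diffLaw W xq.2 (y * xq.1⁻¹)

lemma sum_mul_inv_left (y : G) (f : G → ℝ) : ∑ x : G, f (y * x⁻¹) = ∑ z : G, f z :=
  ((Equiv.inv G).trans (Equiv.mulLeft y)).sum_comp f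

lemma sum_mul_inv_right (x : G) (f : G → ℝ) : ∑ y : G, f (y * x⁻¹) = ∑ z : G, f z :=
  Equiv.sum_comp (Equiv.mulRight x⁻¹) f

lemma card_ne_zero_real : (Fintype.card G : ℝ) ≠ 0 :=
  Nat.cast_ne_zero.mpr Fintype.card_ne_zero

lemma diffLaw_nonneg {W : G × Q → G → ℝ} (hW : IsChannel W) (q : Q) (z : G) :
    0 ≤ diffLaw W q z :=
  mul_nonneg (by positivity) (sum_nonneg fun _ _ => hW.1 _ _)

lemma diffLaw_pos {W : G × Q → G → ℝ} (hW : IsChannel W) {x : G} {q : Q} {y : G}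
    (h : 0 < W (x, q) y) : 0 < diffLaw W q (y * x⁻¹) := by
  have hcard : (0 : ℝ) < Fintype.card G := Nat.cast_pos.mpr Fintype.card_pos
  refine mul_pos (inv_pos.mpr hcard) (sum_pos' (fun _ _ => hW.1 _ _) ⟨x, mem_univ _, ?_⟩)
  simpa using h

lemma sum_diffLaw {W : G × Q → G → ℝ} (hW : IsChannel W) (q : Q) :
    ∑ z : G, diffLaw W q z = 1 := by
  have h (x : G) : ∑ z : G, W (x, q) (z * x) = 1 :=
    (Equiv.sum_comp (Equiv.mulRight x) (W (x, q))).trans (hW.2 _)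
  simp only [diffLaw, ← mul_sum]
  rw [sum_comm]
  simp [h]

lemma isChannel_noiseChannel {W : G × Q → G → ℝ} (hW : IsChannel W) :
    IsChannel (noiseChannel W) :=
  ⟨fun _ _ => diffLaw_nonneg hW _ _, fun xq =>
    (sum_mul_inv_right xq.1 (diffLaw W xq.2)).trans (sum_diffLaw hW _)⟩

/-- Both channels induce the same joint law of `(S, X̂ * X⁻¹)`. -/
lemma sum_jointP_noiseChannel (p : Q → ℝ) (W : G × Q → G → ℝ) (f : Q → G → ℝ) :
    ∑ x : G, ∑ q : Q, ∑ y : G, jointP p (noiseChannel W) x q y * f q (y * x⁻¹) =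
      ∑ x : G, ∑ q : Q, ∑ y : G, jointP p W x q y * f q (y * x⁻¹) := by
  have hl (x : G) (q : Q) : ∑ y : G, jointP p (noiseChannel W) x q y * f q (y * x⁻¹) =
      ∑ z : G, (Fintype.card G : ℝ)⁻¹ * p q * diffLaw W q z * f q z :=
    sum_mul_inv_right x fun z => (Fintype.card G : ℝ)⁻¹ * p q * diffLaw W q z * f q z
  have hr (x : G) (q : Q) : ∑ y : G, jointP p W x q y * f q (y * x⁻¹) =
      ∑ z : G, (Fintype.card G : ℝ)⁻¹ * p q * W (x, q) (z * x) * f q z := by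
    rw [← sum_mul_inv_right x fun z => (Fintype.card G : ℝ)⁻¹ * p q * W (x, q) (z * x) * f q z]
    simp [jointP]
  simp only [hl, hr]
  rw [sum_const, card_univ, nsmul_eq_mul, mul_sum, sum_comm]
  refine sum_congr rfl fun q _ => ?_
  rw [sum_comm, mul_sum]
  refine sum_congr rfl fun z _ => ?_
  rw [← sum_mul, ← mul_sum, diffLaw]
  field_simp [card_ne_zero_real (G := G)]

lemma avgDistortion_noiseChannel (d : G → Q → ℝ) (p : Q → ℝ) (W : G × Q → G → ℝ) :
    avgDistortion d p (noiseChannel W) = avgDistortion d p W :=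
  sum_jointP_noiseChannel p W fun q z => d z q

lemma margXS_eq (p : Q → ℝ) {W : G × Q → G → ℝ} (hW : IsChannel W) (x : G) (q : Q) :
    margXS p W x q = (Fintype.card G : ℝ)⁻¹ * p q := by
  simp [margXS, jointP, ← mul_sum, hW.2]

lemma margS_eq (p : Q → ℝ) {W : G × Q → G → ℝ} (hW : IsChannel W) (q : Q) :
    margS p W q = p q := by
  simp [margS, jointP, ← mul_sum, hW.2]

lemma margSXhat_noiseChannel (p : Q → ℝ) {W : G × Q → G → ℝ} (hW : IsChannel W)
    (q : Q) (y : G) : margSXhat p (noiseChannel W) q y = (Fintype.card G : ℝ)⁻¹ * p q := by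
  simp only [margSXhat, jointP, ← mul_sum, noiseChannel]
  rw [sum_mul_inv_left y (diffLaw W q), sum_diffLaw hW, mul_one]

lemma margXhat_eq_sum (p : Q → ℝ) (W : G × Q → G → ℝ) (y : G) :
    margXhat p W y = ∑ q : Q, margSXhat p W q y :=
  sum_comm

lemma margXhat_noiseChannel {p : Q → ℝ} (hp1 : ∑ q : Q, p q = 1) {W : G × Q → G → ℝ}
    (hW : IsChannel W) (y : G) :
    margXhat p (noiseChannel W) y = (Fintype.card G : ℝ)⁻¹ := by
  simp [margXhat_eq_sum, margSXhat_noiseChannel p hW, ← mul_sum, hp1]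

lemma sum_margSXhat (p : Q → ℝ) {W : G × Q → G → ℝ} (hW : IsChannel W) (q : Q) :
    ∑ y : G, margSXhat p W q y = p q :=
  sum_comm.trans (margS_eq p hW q)

lemma sum_margXhat {p : Q → ℝ} (hp1 : ∑ q : Q, p q = 1) {W : G × Q → G → ℝ}
    (hW : IsChannel W) : ∑ y : G, margXhat p W y = 1 := by
  simp only [margXhat_eq_sum]
  rw [sum_comm]
  simp [sum_margSXhat p hW, hp1]

lemma jointP_nonneg {p : Q → ℝ} (hp0 : ∀ q, 0 ≤ p q) {W : G × Q → G → ℝ} (hW : IsChannel W)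
    (x : G) (q : Q) (y : G) : 0 ≤ jointP p W x q y :=
  mul_nonneg (mul_nonneg (by positivity) (hp0 q)) (hW.1 _ _)

lemma pos_of_jointP_ne_zero {p : Q → ℝ} (hp0 : ∀ q, 0 ≤ p q) {W : G × Q → G → ℝ}
    (hW : IsChannel W) {x : G} {q : Q} {y : G} (h : jointP p W x q y ≠ 0) :
    0 < p q ∧ 0 < W (x, q) y := by
  constructor
  · refine (hp0 q).lt_of_ne fun h0 => h ?_
    simp [jointP, ← h0]
  · refine (hW.1 _ _).lt_of_ne fun h0 => h ?_
    simp [jointP, ← h0]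

lemma jointP_le_margSXhat {p : Q → ℝ} (hp0 : ∀ q, 0 ≤ p q) {W : G × Q → G → ℝ}
    (hW : IsChannel W) (x : G) (q : Q) (y : G) : jointP p W x q y ≤ margSXhat p W q y :=
  single_le_sum (f := fun x => jointP p W x q y)
    (fun _ _ => jointP_nonneg hp0 hW _ _ _) (mem_univ x)

lemma margSXhat_nonneg {p : Q → ℝ} (hp0 : ∀ q, 0 ≤ p q) {W : G × Q → G → ℝ}
    (hW : IsChannel W) (q : Q) (y : G) : 0 ≤ margSXhat p W q y :=
  sum_nonneg fun _ _ => jointP_nonneg hp0 hW _ _ _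

lemma margSXhat_le_margXhat {p : Q → ℝ} (hp0 : ∀ q, 0 ≤ p q) {W : G × Q → G → ℝ}
    (hW : IsChannel W) (q : Q) (y : G) : margSXhat p W q y ≤ margXhat p W y := by
  rw [margXhat_eq_sum]
  exact single_le_sum (f := fun q => margSXhat p W q y)
    (fun _ _ => margSXhat_nonneg hp0 hW _ _) (mem_univ q)

/-- The value `log |G| - H(X̂ * X⁻¹ | S)`. -/
noncomputable def diffInfo (p : Q → ℝ) (W : G × Q → G → ℝ) : ℝ :=
  ∑ x : G, ∑ q : Q, ∑ y : G, jointP p W x q y *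
    Real.log (Fintype.card G * diffLaw W q (y * x⁻¹))

lemma Ienc_noiseChannel {p : Q → ℝ} (hp0 : ∀ q, 0 ≤ p q) (hp1 : ∑ q : Q, p q = 1)
    {W : G × Q → G → ℝ} (hW : IsChannel W) : Ienc p (noiseChannel W) = diffInfo p W := by
  rw [diffInfo, ← sum_jointP_noiseChannel p W fun q z => Real.log (Fintype.card G * diffLaw W q z)]
  have hV := isChannel_noiseChannel hW
  refine sum_congr rfl fun x _ => sum_congr rfl fun q _ => sum_congr rfl fun y _ => ?_
  by_cases h : jointP p (noiseChannel W) x q y = 0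
  · simp [h]
  have hp := (pos_of_jointP_ne_zero hp0 hV h).1.ne'
  have hc := card_ne_zero_real (G := G)
  rw [margXS_eq p hV, margXhat_noiseChannel hp1 hW]
  congr 2
  rw [jointP, noiseChannel]
  field_simp

lemma Iboth_noiseChannel {p : Q → ℝ} (hp0 : ∀ q, 0 ≤ p q)
    {W : G × Q → G → ℝ} (hW : IsChannel W) : Iboth p (noiseChannel W) = diffInfo p W := by
  rw [diffInfo, ← sum_jointP_noiseChannel p W fun q z => Real.log (Fintype.card G * diffLaw W q z)]
  have hV := isChannel_noiseChannel hW
  refine sum_congr rfl fun x _ => sum_congr rfl fun q _ => sum_congr rfl fun y _ => ?_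
  by_cases h : jointP p (noiseChannel W) x q y = 0
  · simp [h]
  have hp := (pos_of_jointP_ne_zero hp0 hV h).1.ne'
  have hc := card_ne_zero_real (G := G)
  rw [margXS_eq p hV, margS_eq p hV, margSXhat_noiseChannel p hW]
  congr 2
  rw [jointP, noiseChannel]
  field_simp

lemma sub_le_mul_log_div {a b : ℝ} (ha : 0 < a) (hb : 0 < b) : a - b ≤ a * Real.log (a / b) := by
  have h := mul_le_mul_of_nonneg_left (Real.one_sub_inv_le_log_of_pos (div_pos ha hb)) ha.le
  rwa [inv_div, mul_sub, mul_one, mul_div_cancel₀ _ ha.ne'] at h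

/-- Gibbs' inequality for the joint law against `c(q, x̂) · diffLaw W q (x̂ * x⁻¹)`. -/
lemma diffInfo_le {p : Q → ℝ} (hp0 : ∀ q, 0 ≤ p q) (hp1 : ∑ q : Q, p q = 1)
    {W : G × Q → G → ℝ} (hW : IsChannel W) {c : Q → G → ℝ} (hc0 : ∀ q y, 0 ≤ c q y)
    (hc1 : ∑ q : Q, ∑ y : G, c q y = 1)
    (hc : ∀ x q y, jointP p W x q y ≠ 0 → 0 < c q y) :
    diffInfo p W ≤ ∑ x : G, ∑ q : Q, ∑ y : G, jointP p W x q y *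
      Real.log (Fintype.card G * jointP p W x q y / c q y) := by
  have hterm (x : G) (q : Q) (y : G) :
      jointP p W x q y * Real.log (Fintype.card G * diffLaw W q (y * x⁻¹)) +
        (jointP p W x q y - c q y * diffLaw W q (y * x⁻¹)) ≤
      jointP p W x q y * Real.log (Fintype.card G * jointP p W x q y / c q y) := by
    by_cases h : jointP p W x q y = 0
    · simpa [h] using mul_nonneg (hc0 q y) (diffLaw_nonneg hW q (y * x⁻¹))
    have hP := (jointP_nonneg hp0 hW x q y).lt_of_ne' h
    have hv := diffLaw_pos hW (pos_of_jointP_ne_zero hp0 hW h).2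
    have hcq := hc x q y h
    have hn := card_ne_zero_real (G := G)
    have hsplit : Fintype.card G * jointP p W x q y / c q y =
        (Fintype.card G * diffLaw W q (y * x⁻¹)) *
          (jointP p W x q y / (c q y * diffLaw W q (y * x⁻¹))) := by
      field_simp
    rw [hsplit, Real.log_mul (mul_ne_zero hn hv.ne') (by positivity),
      mul_add]
    exact add_le_add le_rfl (sub_le_mul_log_div hP (mul_pos hcq hv))
  have hP1 : ∑ x : G, ∑ q : Q, ∑ y : G, jointP p W x q y = 1 := by
    rw [sum_comm]
    exact (sum_congr rfl fun q _ => margS_eq p hW q).trans hp1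
  have hb1 : ∑ x : G, ∑ q : Q, ∑ y : G, c q y * diffLaw W q (y * x⁻¹) = 1 := by
    rw [sum_comm, ← hc1]
    refine sum_congr rfl fun q _ => ?_
    rw [sum_comm]
    refine sum_congr rfl fun y _ => ?_
    rw [← mul_sum, sum_mul_inv_left y (diffLaw W q), sum_diffLaw hW, mul_one]
  have hsum := sum_le_sum fun x (_ : x ∈ univ) => sum_le_sum fun q (_ : q ∈ univ) =>
    sum_le_sum fun y (_ : y ∈ univ) => hterm x q y
  simp only [sum_add_distrib, sum_sub_distrib, hP1, hb1, sub_self, add_zero] at hsum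
  exact hsum

lemma diffInfo_le_Iboth {p : Q → ℝ} (hp0 : ∀ q, 0 ≤ p q) (hp1 : ∑ q : Q, p q = 1)
    {W : G × Q → G → ℝ} (hW : IsChannel W) : diffInfo p W ≤ Iboth p W := by
  refine (diffInfo_le hp0 hp1 hW (margSXhat_nonneg hp0 hW) (by simp [sum_margSXhat p hW, hp1])
    fun x q y h => ((jointP_nonneg hp0 hW x q y).lt_of_ne' h).trans_le
      (jointP_le_margSXhat hp0 hW x q y)).trans_eq ?_
  refine sum_congr rfl fun x _ => sum_congr rfl fun q _ => sum_congr rfl fun y _ => ?_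
  by_cases h : jointP p W x q y = 0
  · simp [h]
  have hp := (pos_of_jointP_ne_zero hp0 hW h).1.ne'
  have hn := card_ne_zero_real (G := G)
  rw [margXS_eq p hW, margS_eq p hW]
  congr 2
  field_simp

lemma diffInfo_le_Ienc {p : Q → ℝ} (hp0 : ∀ q, 0 ≤ p q) (hp1 : ∑ q : Q, p q = 1)
    {W : G × Q → G → ℝ} (hW : IsChannel W) : diffInfo p W ≤ Ienc p W := by
  refine (diffInfo_le hp0 hp1 hW (c := fun q y => p q * margXhat p W y)
    (fun q y => mul_nonneg (hp0 q)
      ((margSXhat_nonneg hp0 hW q y).trans (margSXhat_le_margXhat hp0 hW q y)))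
    (by simp [← mul_sum, sum_margXhat hp1 hW, hp1])
    fun x q y h => mul_pos (pos_of_jointP_ne_zero hp0 hW h).1
      (((jointP_nonneg hp0 hW x q y).lt_of_ne' h).trans_le
        ((jointP_le_margSXhat hp0 hW x q y).trans (margSXhat_le_margXhat hp0 hW q y)))).trans_eq ?_
  refine sum_congr rfl fun x _ => sum_congr rfl fun q _ => sum_congr rfl fun y _ => ?_
  have hn := card_ne_zero_real (G := G)
  rw [margXS_eq p hW]
  congr 2
  field_simp

/-- **Single-letter form of Theorem 1 for finite alphabets.**
For a source uniform on a finite group `G`, independent side information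
`S ~ p`, and a group-difference distortion `d(x ⊖ x̂, q)`, the rate-distortion
function with encoder-only side information equals the one with side
information at both ends:
`inf { I((X,S); X̂) : Δ(W) ≤ D } = inf { I(X; X̂ | S) : Δ(W) ≤ D }`. -/
theorem renc_eq_rboth (p : Q → ℝ) (hp0 : ∀ q, 0 ≤ p q) (hp1 : ∑ q : Q, p q = 1)
    (d : G → Q → ℝ) (D : ℝ)
    (hne : ∃ W : G × Q → G → ℝ, IsChannel W ∧ avgDistortion d p W ≤ D) :
    sInf {r : ℝ | ∃ W : G × Q → G → ℝ,
        IsChannel W ∧ avgDistortion d p W ≤ D ∧ r = Ienc p W} =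
    sInf {r : ℝ | ∃ W : G × Q → G → ℝ,
        IsChannel W ∧ avgDistortion d p W ≤ D ∧ r = Iboth p W} := by
  apply csInf_eq_csInf_of_forall_exists_le
  · rintro _ ⟨W, hW, hD, rfl⟩
    exact ⟨_, ⟨noiseChannel W, isChannel_noiseChannel hW,
      (avgDistortion_noiseChannel d p W).trans_le hD, rfl⟩,
      (Iboth_noiseChannel hp0 hW).trans_le (diffInfo_le_Ienc hp0 hp1 hW)⟩
  · rintro _ ⟨W, hW, hD, rfl⟩
    exact ⟨_, ⟨noiseChannel W, isChannel_noiseChannel hW,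
      (avgDistortion_noiseChannel d p W).trans_le hD, rfl⟩,
      (Ienc_noiseChannel hp0 hp1 hW).trans_le (diffInfo_le_Iboth hp0 hp1 hW)⟩

end SourceCodingDSI
end
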